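/- Let m and n be positive integers and λ_a ∈ {2,3}. Suppose either (i) mn ≡ 0 (mod 32) and both m and n are even, or (ii) mn ≡ 16 (mod 32), both m and n are even, and not both m and n are divisible by 4. Then every (m,n,3,λ_a,1)-OOSPC has at most ⌊(13mn+32+32ω)/64⌋ codewords. -/

import Mathlib

open Finset

/-- An (m,n,k,lamA,lamC)-OOSPC: a family of k-subsets of Z_m x Z_n with
auto-correlation at most lamA and cross-correlation at most lamC. -/
def OOSPC (m n k lamA lamC : ℕ) (F : Finset (Finset (ZMod m × ZMod n))) : Prop :=
  (∀ X ∈ F, X.card = k) ∧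
  (∀ X ∈ F, ∀ g : ZMod m × ZMod n, g ≠ 0 →
    (X ∩ X.image (fun x => g + x)).card ≤ lamA) ∧
  (∀ X ∈ F, ∀ Y ∈ F, X ≠ Y → ∀ g : ZMod m × ZMod n,
    (X ∩ Y.image (fun x => g + x)).card ≤ lamC)

/-- The leave of a family: nonzero elements of Z_m x Z_n not occurring as a
difference of two elements of a member of the family. -/
def leave (m n : ℕ) (F : Finset (Finset (ZMod m × ZMod n))) : Set (ZMod m × ZMod n) :=
  {g | g ≠ 0 ∧ ∀ X ∈ F, ∀ x ∈ X, ∀ y ∈ X, x - y ≠ g}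

/-- (s,t)-regularity: the leave together with 0 equals S × T, where S and T are the
unique subgroups of order s of Z_m and of order t of Z_n (for s ∣ m, t ∣ n these are
exactly the elements killed by s, resp. t). -/
def Regular (m n s t : ℕ) (F : Finset (Finset (ZMod m × ZMod n))) : Prop :=
  insert (0 : ZMod m × ZMod n) (leave m n F) =
    {p : ZMod m × ZMod n | s • p.1 = 0 ∧ t • p.2 = 0}

/-- ξ: the number of subgroups of order 3 in Z_m × Z_n. -/
def xi (m n : ℕ) : ℕ := if 3 ∣ m ∧ 3 ∣ n then 4 else if 3 ∣ m * n then 1 else 0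

/-- ω = 0 if lamA = 2, and ω = ξ if lamA = 3. -/
def omega (lamA m n : ℕ) : ℕ := if lamA = 2 then 0 else xi m n

/-- Weight of a residue class in `ZMod 2 × ZMod 8`: classes whose second coordinate is odd have
weight 1, the others weight 2, and the two classes containing doubles of odd ones weight 3. -/
def classWeight (p : ZMod 2 × ZMod 8) : ℕ :=
  (if 4 * p.2 = 0 then 2 else 1) + (if p.1 = 0 ∧ (p.2 = 2 ∨ p.2 = 6) then 1 else 0)

/-- Weight of a group element: its class weight, plus 2 if it is killed by 2, plus `c` if it is
killed by 3. -/
def elementWeight {G : Type*} [AddCommGroup G] [DecidableEq G] (ψ : G →+ ZMod 2 × ZMod 8)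
    (c : ℕ) (g : G) : ℕ :=
  classWeight (ψ g) + (if 2 • g = 0 then 2 else 0) + (if 3 • g = 0 then c else 0)

/-- The set of nonzero differences of elements of `X`. -/
def differences {G : Type*} [AddCommGroup G] [DecidableEq G] (X : Finset G) : Finset G :=
  X.offDiag.image fun p => p.1 - p.2

theorem neg_ne_self_of_two_nsmul {G : Type*} [AddCommGroup G] {g : G} (h : 2 • g ≠ 0) : g ≠ -g := fun e =>
  h (by rw [two_nsmul]; nth_rewrite 1 [e]; simp)

theorem sum_comp_surjective_hom {G H : Type*} [AddCommGroup G] [Fintype G] [AddCommGroup H]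
    [Fintype H] [DecidableEq H]
    (ψ : G →+ H) (hψ : Function.Surjective ψ) (f : H → ℕ) :
    Fintype.card H * ∑ g : G, f (ψ g) = Fintype.card G * ∑ h : H, f h := by
  have hfib : ∀ h : H, (univ.filter fun g => ψ g = h).card =
      (univ.filter fun g => ψ g = 0).card := fun h =>
    AddMonoidHom.card_fiber_eq_of_mem_range ψ (hψ h) (hψ 0)
  have key : ∀ e : H → ℕ, ∑ g : G, e (ψ g) =
      (univ.filter fun g => ψ g = 0).card * ∑ h : H, e h := by
    intro e
    rw [← sum_fiberwise_of_maps_to (g := ψ) (t := univ) (fun _ _ => mem_univ _), mul_sum]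
    refine sum_congr rfl fun h _ => ?_
    rw [← hfib h, sum_congr rfl (g := fun _ => e h) fun g hg => by rw [(mem_filter.1 hg).2]]
    simp
  have hcard := key fun _ => 1
  simp only [sum_const, card_univ, smul_eq_mul, mul_one] at hcard
  rw [key f, hcard]; ring

section Weights

variable {G : Type*} [AddCommGroup G] [DecidableEq G]

theorem mem_differences {X : Finset G} {x y : G} (hx : x ∈ X) (hy : y ∈ X) (hxy : x ≠ y) :
    x - y ∈ differences X :=
  mem_image.2 ⟨(x, y), mem_offDiag.2 ⟨hx, hy, hxy⟩, rfl⟩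

theorem classWeight_le_elementWeight (ψ : G →+ ZMod 2 × ZMod 8) (c : ℕ) (g : G) :
    classWeight (ψ g) ≤ elementWeight ψ c g := by
  unfold elementWeight; omega

theorem two_le_classWeight_of_four_nsmul {p : ZMod 2 × ZMod 8} (h : 4 • p = 0) :
    2 ≤ classWeight p := by
  revert p; decide

theorem one_le_classWeight (p : ZMod 2 × ZMod 8) : 1 ≤ classWeight p := by
  revert p; decide

theorem classWeight_double (p : ZMod 2 × ZMod 8) :
    8 ≤ classWeight p + classWeight (-p) + classWeight (2 • p) + classWeight (-(2 • p)) := by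
  revert p; decide

set_option maxRecDepth 10000 in
theorem classWeight_triple (p q : ZMod 2 × ZMod 8) :
    8 ≤ classWeight p + classWeight (-p) + classWeight q + classWeight (-q) +
      classWeight (p + q) + classWeight (-(p + q)) := by
  revert p q; decide

theorem elementWeight_involution (ψ : G →+ ZMod 2 × ZMod 8) (c : ℕ) {g : G}
    (h : 2 • g = 0) : 4 ≤ elementWeight ψ c g := by
  have h4 : 4 • ψ g = 0 := by
    rw [← map_nsmul, show (4 : ℕ) = 2 * 2 from rfl, mul_nsmul, h]; simp
  have := two_le_classWeight_of_four_nsmul h4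
  simp only [elementWeight, h, if_true]; omega

theorem elementWeight_of_four_nsmul (ψ : G →+ ZMod 2 × ZMod 8) (c : ℕ) {g : G}
    (h : 4 • g = 0) : 2 ≤ elementWeight ψ c g :=
  (two_le_classWeight_of_four_nsmul (by rw [← map_nsmul, h, map_zero])).trans
    (classWeight_le_elementWeight ψ c g)

theorem elementWeight_of_three_nsmul (ψ : G →+ ZMod 2 × ZMod 8) {c : ℕ} (hc : 2 ≤ c) {g : G}
    (h : 3 • g = 0) : 4 ≤ elementWeight ψ c g := by
  have h0 : ∀ p : ZMod 2 × ZMod 8, 3 • p = 0 → 2 ≤ classWeight p := by decide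
  have := h0 (ψ g) (by rw [← map_nsmul, h, map_zero])
  simp only [elementWeight, h, if_true]; omega

theorem one_le_elementWeight (ψ : G →+ ZMod 2 × ZMod 8) (c : ℕ) (g : G) :
    1 ≤ elementWeight ψ c g :=
  (one_le_classWeight _).trans (classWeight_le_elementWeight ψ c g)

theorem sum_elementWeight_of_involution (ψ : G →+ ZMod 2 × ZMod 8) (c : ℕ) {D : Finset G}
    {a b d : G} (hsum : a + b + d = 0) (ha : a ≠ 0) (hd : d ≠ 0)
    (haD : a ∈ D) (hbD : b ∈ D) (hbD' : -b ∈ D) (hdD : d ∈ D) (hdD' : -d ∈ D)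
    (h2 : 2 • a = 0) : 8 ≤ ∑ g ∈ D, elementWeight ψ c g := by
  have hwa := elementWeight_involution ψ c h2
  have had : d = -a - b := by
    rw [eq_sub_iff_add_eq, eq_neg_iff_add_eq_zero, ← hsum]; abel
  have haa : -a = a := by
    rw [neg_eq_iff_add_eq_zero, ← two_nsmul, h2]
  have hda : d = a - b := by rw [had, haa]
  have hab : a ≠ b := fun e => hd (by rw [hda, e, sub_self])
  by_cases hb2 : 2 • b = 0
  · have hwb := elementWeight_involution ψ c hb2
    have hsub : ({a, b} : Finset G) ⊆ D := by
      intro x; simp only [mem_insert, mem_singleton]; rintro (rfl | rfl) <;> assumption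
    have := sum_le_sum_of_subset (f := elementWeight ψ c) hsub
    rw [sum_pair hab] at this
    omega
  have hbb := neg_ne_self_of_two_nsmul hb2
  have hab' : a ≠ -b := fun e => hab (by rw [← haa, e, neg_neg])
  by_cases hbd : b = d
  · have hab2 : a = 2 • b := by
      rw [two_nsmul]; nth_rewrite 1 [hbd]; rw [hda]; abel
    have h4 : 4 • b = 0 := by
      rw [show (4 : ℕ) = 2 * 2 from rfl, mul_nsmul, ← hab2, h2]
    have hwb := elementWeight_of_four_nsmul ψ c h4
    have hwb' := elementWeight_of_four_nsmul ψ c (g := -b) (by rw [neg_nsmul, h4, neg_zero])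
    have hsub : ({a, b, -b} : Finset G) ⊆ D := by
      intro x; simp only [mem_insert, mem_singleton]; rintro (rfl | rfl | rfl) <;> assumption
    have := sum_le_sum_of_subset (f := elementWeight ψ c) hsub
    rw [sum_insert (by simp [hab, hab']), sum_pair hbb] at this
    omega
  · have hbd' : b ≠ -d := fun e => ha (by rw [hda] at e; simpa using e.symm)
    have hd2 : 2 • d ≠ 0 := by rwa [hda, nsmul_sub, h2, zero_sub, neg_ne_zero]
    have hdd := neg_ne_self_of_two_nsmul hd2
    have hb0 : b ≠ 0 := fun e => hb2 (by simp [e])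
    have had1 : a ≠ d := fun e => hb0 (by rw [hda] at e; exact sub_eq_self.1 e.symm)
    have had2 : a ≠ -d := fun e => had1 (by rw [← haa, e, neg_neg])
    have h1 := one_le_elementWeight ψ c b
    have h1' := one_le_elementWeight ψ c (-b)
    have h3 := one_le_elementWeight ψ c d
    have h3' := one_le_elementWeight ψ c (-d)
    have hsub : ({a, b, -b, d, -d} : Finset G) ⊆ D := by
      intro x; simp only [mem_insert, mem_singleton]
      rintro (rfl | rfl | rfl | rfl | rfl) <;> assumption
    have := sum_le_sum_of_subset (f := elementWeight ψ c) hsub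
    rw [sum_insert (by simp [hab, hab', had1, had2]), sum_insert (by simp [hbb, hbd, hbd']),
      sum_insert (by
        simp only [mem_insert, mem_singleton, not_or, neg_inj]
        exact ⟨fun e => hbd' (by rw [← e, neg_neg]), hbd⟩), sum_pair hdd] at this
    omega

theorem sum_elementWeight_of_progression (ψ : G →+ ZMod 2 × ZMod 8) (c : ℕ) {D : Finset G}
    {a d : G} (hsum : a + a + d = 0) (ha2 : 2 • a ≠ 0) (hd2 : 2 • d ≠ 0)
    (haD : a ∈ D) (haD' : -a ∈ D) (hdD : d ∈ D) (hdD' : -d ∈ D)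
    (hc : a = d → 2 ≤ c) : 8 ≤ ∑ g ∈ D, elementWeight ψ c g := by
  have haa := neg_ne_self_of_two_nsmul ha2
  have hdd := neg_ne_self_of_two_nsmul hd2
  by_cases had : a = d
  · have h3 : 3 • a = 0 := by
      rw [← hsum, ← had, succ_nsmul, two_nsmul]
    have h1 := elementWeight_of_three_nsmul ψ (hc had) h3
    have h2 := elementWeight_of_three_nsmul ψ (hc had) (g := -a) (by rw [neg_nsmul, h3, neg_zero])
    have hsub : ({a, -a} : Finset G) ⊆ D := by
      intro x; simp only [mem_insert, mem_singleton]; rintro (rfl | rfl) <;> assumption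
    have := sum_le_sum_of_subset (f := elementWeight ψ c) hsub
    rw [sum_pair haa] at this
    omega
  · have hd : d = -(2 • a) := by
      rw [eq_neg_iff_add_eq_zero, two_nsmul, ← hsum]; abel
    have had' : a ≠ -d := by
      intro e
      apply ha2
      rw [hd, neg_neg] at e
      have h0 : a = 0 := by rw [two_nsmul] at e; simpa using e
      simp [h0]
    have hsub : ({a, -a, d, -d} : Finset G) ⊆ D := by
      intro x; simp only [mem_insert, mem_singleton]
      rintro (rfl | rfl | rfl | rfl) <;> assumption
    have := sum_le_sum_of_subset (f := elementWeight ψ c) hsub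
    rw [sum_insert (by simp [haa, had, had']),
      sum_insert (by
        simp only [mem_insert, mem_singleton, not_or, neg_inj]
        exact ⟨fun e => had' (by rw [← e, neg_neg]), had⟩), sum_pair hdd] at this
    have h := classWeight_double (ψ a)
    have e1 := classWeight_le_elementWeight ψ c a
    have e2 := classWeight_le_elementWeight ψ c (-a)
    have e3 := classWeight_le_elementWeight ψ c d
    have e4 := classWeight_le_elementWeight ψ c (-d)
    simp only [hd, map_neg, map_nsmul, neg_neg] at e1 e2 e3 e4 this
    omega

theorem sum_elementWeight_of_generic (ψ : G →+ ZMod 2 × ZMod 8) (c : ℕ) {D : Finset G}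
    {a b d : G} (hsum : a + b + d = 0) (ha2 : 2 • a ≠ 0) (hb2 : 2 • b ≠ 0) (hd2 : 2 • d ≠ 0)
    (hab : a ≠ b) (had : a ≠ d) (hbd : b ≠ d)
    (haD : a ∈ D) (haD' : -a ∈ D) (hbD : b ∈ D) (hbD' : -b ∈ D) (hdD : d ∈ D) (hdD' : -d ∈ D) :
    8 ≤ ∑ g ∈ D, elementWeight ψ c g := by
  have haa := neg_ne_self_of_two_nsmul ha2
  have hbb := neg_ne_self_of_two_nsmul hb2
  have hdd := neg_ne_self_of_two_nsmul hd2
  have ne_zero : ∀ {g : G}, 2 • g ≠ 0 → g ≠ 0 := fun h e => h (by simp [e])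
  have hab' : a ≠ -b := fun e => ne_zero hd2 (by rw [e] at hsum; simpa using hsum)
  have hbd' : b ≠ -d := fun e => ne_zero ha2 (by rw [e] at hsum; simpa using hsum)
  have had' : a ≠ -d := fun e => ne_zero hb2 (by
    rw [e, add_right_comm] at hsum; simpa using hsum)
  have hsub : ({a, -a, b, -b, d, -d} : Finset G) ⊆ D := by
    intro x; simp only [mem_insert, mem_singleton]
    rintro (rfl | rfl | rfl | rfl | rfl | rfl) <;> assumption
  have := sum_le_sum_of_subset (f := elementWeight ψ c) hsub
  rw [sum_insert (by simp [haa, hab, hab', had, had']),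
    sum_insert (by simp [neg_eq_iff_eq_neg, hab, hab', had, had']),
    sum_insert (by simp [hbb, hbd, hbd']),
    sum_insert (by simp [neg_eq_iff_eq_neg, hbd, hbd']), sum_pair hdd] at this
  have h := classWeight_triple (ψ a) (ψ b)
  have hd : d = -(a + b) := by rw [eq_neg_iff_add_eq_zero, ← hsum]; abel
  have e1 := classWeight_le_elementWeight ψ c a
  have e2 := classWeight_le_elementWeight ψ c (-a)
  have e3 := classWeight_le_elementWeight ψ c b
  have e4 := classWeight_le_elementWeight ψ c (-b)
  have e5 := classWeight_le_elementWeight ψ c d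
  have e6 := classWeight_le_elementWeight ψ c (-d)
  rw [map_neg] at e2 e4
  rw [show ψ d = -(ψ a + ψ b) by rw [hd, map_neg, map_add]] at e5
  rw [show ψ (-d) = ψ a + ψ b by rw [hd, neg_neg, map_add]] at e6
  omega

theorem sum_elementWeight_differences (ψ : G →+ ZMod 2 × ZMod 8) (c : ℕ) {X : Finset G}
    (hX : X.card = 3)
    (hc : ∀ x y z : G, X = {x, y, z} → x ≠ y → x - y = y - z → y - z = z - x → 2 ≤ c) :
    8 ≤ ∑ g ∈ differences X, elementWeight ψ c g := by
  obtain ⟨x, y, z, hxy, hxz, hyz, rfl⟩ := card_eq_three.1 hX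
  have hx : x ∈ ({x, y, z} : Finset G) := by simp
  have hy : y ∈ ({x, y, z} : Finset G) := by simp
  have hz : z ∈ ({x, y, z} : Finset G) := by simp
  have haD := mem_differences hx hy hxy
  have haD' := mem_differences hy hx hxy.symm
  have hbD := mem_differences hy hz hyz
  have hbD' := mem_differences hz hy hyz.symm
  have hdD := mem_differences hz hx hxz.symm
  have hdD' := mem_differences hx hz hxz
  have hcc := hc x y z rfl hxy
  have ha := sub_ne_zero.2 hxy
  have hb := sub_ne_zero.2 hyz
  have hd := sub_ne_zero.2 hxz.symm
  have hsum : x - y + (y - z) + (z - x) = 0 := by abel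
  rw [← neg_sub] at haD' hbD' hdD'
  generalize x - y = a at *
  generalize y - z = b at *
  generalize z - x = d at *
  by_cases ha2 : 2 • a = 0
  · exact sum_elementWeight_of_involution ψ c hsum ha hd haD hbD hbD' hdD hdD' ha2
  by_cases hb2 : 2 • b = 0
  · exact sum_elementWeight_of_involution ψ c (a := b) (b := d) (d := a)
      (by rw [← hsum]; abel) hb ha hbD hdD hdD' haD haD' hb2
  by_cases hd2 : 2 • d = 0
  · exact sum_elementWeight_of_involution ψ c (a := d) (b := a) (d := b)
      (by rw [← hsum]; abel) hd hb hdD haD haD' hbD hbD' hd2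
  by_cases hab : a = b
  · exact sum_elementWeight_of_progression ψ c (a := a) (d := d) (by rw [← hsum, ← hab])
      ha2 hd2 haD haD' hdD hdD' fun h => hcc hab (hab ▸ h)
  by_cases hbd : b = d
  · exact sum_elementWeight_of_progression ψ c (a := b) (d := a)
      (by rw [← hsum, ← hbd]; abel) hb2 ha2 hbD hbD' haD haD' fun h => absurd h.symm hab
  by_cases had : a = d
  · exact sum_elementWeight_of_progression ψ c (a := a) (d := b)
      (by rw [← hsum, ← had]; abel) ha2 hb2 haD haD' hbD hbD' fun h => absurd h hab
  exact sum_elementWeight_of_generic ψ c hsum ha2 hb2 hd2 hab had hbd haD haD' hbD hbD' hdD hdD'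

variable [Fintype G]

theorem card_family_le (ψ : G →+ ZMod 2 × ZMod 8) (hψ : Function.Surjective ψ) (c T : ℕ)
    (F : Finset (Finset G)) (hcard : ∀ X ∈ F, X.card = 3)
    (hdisj : (F : Set (Finset G)).PairwiseDisjoint differences)
    (hc : ∀ X ∈ F, ∀ x y z : G, X = {x, y, z} → x ≠ y → x - y = y - z → y - z = z - x → 2 ≤ c)
    (h2 : (univ.filter fun g : G => 2 • g = 0).card ≤ 4)
    (h3 : (univ.filter fun g : G => 3 • g = 0).card ≤ T + 1) :
    64 * F.card ≤ 13 * Fintype.card G + 32 + 8 * (c * T) := by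
  have hlower : F.card * 8 ≤ ∑ X ∈ F, ∑ g ∈ differences X, elementWeight ψ c g := by
    rw [← smul_eq_mul]
    exact card_nsmul_le_sum _ _ _ fun X hX =>
      sum_elementWeight_differences ψ c (hcard X hX) (hc X hX)
  rw [← sum_biUnion hdisj] at hlower
  have hzero : (0 : G) ∉ F.biUnion differences := by
    simp only [mem_biUnion, differences, mem_image, mem_offDiag, not_exists, not_and]
    rintro X - ⟨x, y⟩ ⟨-, -, hxy⟩ h
    exact hxy (sub_eq_zero.1 h)
  have hupper := sum_le_sum_of_subset (f := elementWeight ψ c)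
    (subset_univ (insert (0 : G) (F.biUnion differences)))
  rw [sum_insert hzero] at hupper
  have hw0 : elementWeight ψ c 0 = 4 + c := by
    have : classWeight 0 = 2 := by decide
    simp [elementWeight, this]
  have htotal : ∑ g : G, elementWeight ψ c g = ∑ g : G, classWeight (ψ g) +
      (univ.filter fun g : G => 2 • g = 0).card * 2 +
      (univ.filter fun g : G => 3 • g = 0).card * c := by
    simp only [elementWeight, sum_add_distrib, ← sum_filter, sum_const, smul_eq_mul]
  have hclass := sum_comp_surjective_hom ψ hψ classWeight
  have h26 : ∑ p, classWeight p = 26 := by decide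
  rw [h26, show Fintype.card (ZMod 2 × ZMod 8) = 16 from rfl] at hclass
  have h3c := Nat.mul_le_mul_right c h3
  have hring : (T + 1) * c = c * T + c := by ring
  omega

end Weights

theorem OOSPC.pairwiseDisjoint_differences {m n k lamA : ℕ}
    {F : Finset (Finset (ZMod m × ZMod n))} (hF : OOSPC m n k lamA 1 F) :
    (F : Set (Finset (ZMod m × ZMod n))).PairwiseDisjoint differences := by
  intro X hX Y hY hXY
  rw [Function.onFun, disjoint_left]
  simp only [differences, mem_image, mem_offDiag]
  rintro g ⟨⟨x, x'⟩, ⟨hx, hx', hne⟩, rfl⟩ ⟨⟨y, y'⟩, ⟨hy, hy', -⟩, h⟩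
  simp only at hx hx' hne hy hy' h
  have hle := hF.2.2 X hX Y hY hXY (x - y)
  have hsub : ({x, x'} : Finset _) ⊆ X ∩ Y.image (fun z => (x - y) + z) := by
    intro z
    simp only [mem_insert, mem_singleton, mem_inter, mem_image]
    rintro (rfl | rfl)
    · exact ⟨hx, y, hy, by abel⟩
    · refine ⟨hx', y', hy', ?_⟩
      rw [← sub_eq_zero, show x - y + y' - z = (x - z) - (y - y') by abel, h, sub_self]
  have := card_le_card hsub
  rw [card_pair hne] at this
  omega

theorem OOSPC.not_periodic {m n lamC : ℕ} {F : Finset (Finset (ZMod m × ZMod n))}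
    (hF : OOSPC m n 3 2 lamC F) {X : Finset (ZMod m × ZMod n)} (hX : X ∈ F)
    {x y z : ZMod m × ZMod n} (hxyz : X = {x, y, z}) (hxy : x ≠ y)
    (h1 : x - y = y - z) (h2 : y - z = z - x) : False := by
  have hle := hF.2.1 X hX (x - y) (sub_ne_zero.2 hxy)
  have hsub : X ⊆ X ∩ X.image (fun w => (x - y) + w) := by
    intro w hw
    refine mem_inter.2 ⟨hw, mem_image.2 ?_⟩
    rw [hxyz] at hw ⊢
    simp only [mem_insert, mem_singleton] at hw
    rcases hw with rfl | rfl | rfl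
    · exact ⟨y, by simp, by abel⟩
    · exact ⟨z, by simp, by rw [h1]; abel⟩
    · exact ⟨x, by simp, by rw [h1, h2]; abel⟩
  have := card_le_card hsub
  rw [hF.1 X hX] at this
  omega

theorem card_torsion_prod_le (m n k a b : ℕ) [NeZero m] [NeZero n]
    (hm : (univ.filter fun x : ZMod m => k • x = 0).card ≤ a)
    (hn : (univ.filter fun x : ZMod n => k • x = 0).card ≤ b) :
    (univ.filter fun g : ZMod m × ZMod n => k • g = 0).card ≤ a * b := by
  have : (univ.filter fun g : ZMod m × ZMod n => k • g = 0) =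
      (univ.filter fun x : ZMod m => k • x = 0) ×ˢ (univ.filter fun x : ZMod n => k • x = 0) := by
    ext ⟨x, y⟩
    simp only [mem_filter, mem_univ, true_and, mem_product, Prod.smul_mk, Prod.mk_eq_zero]
  rw [this, card_product]
  exact Nat.mul_le_mul hm hn

theorem card_torsion_le (m k : ℕ) [NeZero m] (hk : 0 < k) :
    (univ.filter fun x : ZMod m => k • x = 0).card ≤ k :=
  IsAddCyclic.card_nsmul_eq_zero_le hk

theorem card_three_torsion_le_one {m : ℕ} [NeZero m] (hm : ¬ 3 ∣ m) :
    (univ.filter fun x : ZMod m => 3 • x = 0).card ≤ 1 := by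
  rw [card_le_one]
  have h0 : ∀ x : ZMod m, 3 • x = 0 → x = 0 := by
    intro x hx
    have hu : IsUnit ((3 : ℕ) : ZMod m) :=
      (ZMod.isUnit_iff_coprime 3 m).2 ((Nat.Prime.coprime_iff_not_dvd Nat.prime_three).2 hm)
    rw [nsmul_eq_mul] at hx
    exact hu.mul_right_eq_zero.1 hx
  simp only [mem_filter, mem_univ, true_and]
  intro x hx y hy
  rw [h0 x hx, h0 y hy]

theorem card_three_torsion_le (m n : ℕ) [NeZero m] [NeZero n] :
    (univ.filter fun g : ZMod m × ZMod n => 3 • g = 0).card ≤ 2 * xi m n + 1 := by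
  have hm := card_torsion_le m 3 (by norm_num)
  have hn := card_torsion_le n 3 (by norm_num)
  unfold xi
  by_cases h3m : 3 ∣ m <;> by_cases h3n : 3 ∣ n <;>
    simp only [h3m, h3n, Nat.prime_three.dvd_mul, and_true, and_false, or_true, or_false,
      if_true, if_false, and_self, or_self]
  · exact card_torsion_prod_le m n 3 3 3 hm hn
  · exact card_torsion_prod_le m n 3 3 1 hm (card_three_torsion_le_one h3n)
  · exact card_torsion_prod_le m n 3 1 3 (card_three_torsion_le_one h3m) hn
  · exact card_torsion_prod_le m n 3 1 1 (card_three_torsion_le_one h3m)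
      (card_three_torsion_le_one h3n)

theorem exists_surjective_hom {m n : ℕ} (h : (2 ∣ m ∧ 8 ∣ n) ∨ (8 ∣ m ∧ 2 ∣ n)) :
    ∃ ψ : ZMod m × ZMod n →+ ZMod 2 × ZMod 8, Function.Surjective ψ := by
  rcases h with ⟨h1, h2⟩ | ⟨h1, h2⟩
  · exact ⟨(ZMod.castHom h1 (ZMod 2)).toAddMonoidHom.prodMap
      (ZMod.castHom h2 (ZMod 8)).toAddMonoidHom,
      (ZMod.castHom_surjective h1).prodMap (ZMod.castHom_surjective h2)⟩
  · refine ⟨((ZMod.castHom h2 (ZMod 2)).toAddMonoidHom.prodMap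
      (ZMod.castHom h1 (ZMod 8)).toAddMonoidHom).comp (AddEquiv.prodComm).toAddMonoidHom,
      ?_⟩
    exact ((ZMod.castHom_surjective h2).prodMap (ZMod.castHom_surjective h1)).comp
      Prod.swap_surjective

theorem eight_dvd_of_sixteen_dvd_mul {m n : ℕ} (hm : 2 ∣ m) (hn : 2 ∣ n) (h16 : 16 ∣ m * n)
    (h : 32 ∣ m * n ∨ ¬ (4 ∣ m ∧ 4 ∣ n)) : (2 ∣ m ∧ 8 ∣ n) ∨ (8 ∣ m ∧ 2 ∣ n) := by
  obtain ⟨a, rfl⟩ := hm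
  obtain ⟨b, rfl⟩ := hn
  have hab : 4 ∣ a * b := by
    rw [show 2 * a * (2 * b) = 4 * (a * b) by ring] at h16
    omega
  suffices 4 ∣ b ∨ 4 ∣ a by omega
  by_cases ha : 2 ∣ a
  · by_cases hb : 2 ∣ b
    · obtain ⟨a, rfl⟩ := ha
      obtain ⟨b, rfl⟩ := hb
      have h32 : 32 ∣ 2 * (2 * a) * (2 * (2 * b)) := h.resolve_right (by omega)
      have h2 : 2 ∣ a * b := by
        rw [show 2 * (2 * a) * (2 * (2 * b)) = 16 * (a * b) by ring] at h32
        omega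
      rcases Nat.prime_two.dvd_mul.1 h2 with h | h <;> omega
    · have : Nat.Coprime (2 ^ 2) b :=
        (Nat.prime_two.coprime_iff_not_dvd.2 hb).pow_left 2
      exact Or.inr (this.dvd_of_dvd_mul_right hab)
  · have : Nat.Coprime (2 ^ 2) a :=
      (Nat.prime_two.coprime_iff_not_dvd.2 ha).pow_left 2
    exact Or.inl (this.dvd_of_dvd_mul_left hab)

theorem stmt7 (m n lamA : ℕ) (hm : 0 < m) (hn : 0 < n)
    (hcase : (m * n % 32 = 0 ∧ 2 ∣ m ∧ 2 ∣ n) ∨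
      (m * n % 32 = 16 ∧ 2 ∣ m ∧ 2 ∣ n ∧ ¬ (4 ∣ m ∧ 4 ∣ n)))
    (hl : lamA = 2 ∨ lamA = 3)
    (F : Finset (Finset (ZMod m × ZMod n))) (hF : OOSPC m n 3 lamA 1 F) :
    F.card ≤ (13 * m * n + 32 + 32 * omega lamA m n) / 64 := by
  have : NeZero m := ⟨hm.ne'⟩
  have : NeZero n := ⟨hn.ne'⟩
  have h8 : (2 ∣ m ∧ 8 ∣ n) ∨ (8 ∣ m ∧ 2 ∣ n) := by
    rcases hcase with ⟨h, h1, h2⟩ | ⟨h, h1, h2, h4⟩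
    · exact eight_dvd_of_sixteen_dvd_mul h1 h2 (by omega) (Or.inl (by omega))
    · exact eight_dvd_of_sixteen_dvd_mul h1 h2 (by omega) (Or.inr h4)
  obtain ⟨ψ, hψ⟩ := exists_surjective_hom h8
  have h2 : (univ.filter fun g : ZMod m × ZMod n => 2 • g = 0).card ≤ 4 :=
    card_torsion_prod_le m n 2 2 2 (card_torsion_le m 2 (by norm_num))
      (card_torsion_le n 2 (by norm_num))
  have h3 := card_three_torsion_le m n
  have hbound := fun c hc => card_family_le ψ hψ c _ F hF.1 hF.pairwiseDisjoint_differences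
    hc h2 h3
  rw [Fintype.card_prod, ZMod.card, ZMod.card, ← mul_assoc] at hbound
  rw [Nat.le_div_iff_mul_le (by norm_num), mul_comm]
  rcases hl with rfl | rfl
  · have := hbound 0 fun X hX x y z hX' hne e1 e2 => (hF.not_periodic hX hX' hne e1 e2).elim
    simpa [omega] using this
  · have := hbound 2 fun _ _ _ _ _ _ _ _ _ => le_rfl
    have hω : omega 3 m n = xi m n := by simp [omega]
    rw [hω]
    omega
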